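/- arXiv:1305.1735 — 4 statements merged into one kernel-verified Lean document; each statement's English description precedes it below -/
import Mathlib

section
/- (Proposition 1) Let N ≥ 2 and let α¹, …, αᴺ be random variables on a probability space taking values in the symmetric group S_L, with consecutive transcripts τⁿ = αⁿ⁺¹·(αⁿ)⁻¹ for 1 ≤ n ≤ N−1. Then for all 1 ≤ i, j ≤ N, the conditional entropies agree: H(αⁱ | (τ¹, …, τᴺ⁻¹)) = H(αʲ | (τ¹, …, τᴺ⁻¹)). -/
open MeasureTheory Real

/-- Shannon entropy (natural logarithm) of a random variable `X` with values in a
finite set, with respect to the measure `μ`. -/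
noncomputable def entropy {Ω S : Type*} [MeasurableSpace Ω] [Fintype S]
    (μ : Measure Ω) (X : Ω → S) : ℝ :=
  ∑ s : S, Real.negMulLog ((μ (X ⁻¹' {s})).toReal)

/-- The consecutive transcripts `τⁿ = αⁿ⁺¹·(αⁿ)⁻¹`, `1 ≤ n ≤ N-1`, of a family
`α¹, …, αᴺ` of `S_L`-valued random variables. -/
def transcripts {Ω : Type*} {L N : ℕ} (α : Fin N → Ω → Equiv.Perm (Fin L)) :
    Fin (N - 1) → Ω → Equiv.Perm (Fin L) :=
  fun n ω => α ⟨n.1 + 1, by have := n.2; omega⟩ ω * (α ⟨n.1, by have := n.2; omega⟩ ω)⁻¹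

/-- The multivariate coupling complexity index
`C(α¹,…,αᴺ) = min_n H(αⁿ) − [H(α¹,…,αᴺ) − H(τ¹,…,τᴺ⁻¹)]`. -/
noncomputable def cci {Ω : Type*} [MeasurableSpace Ω] (μ : Measure Ω) {L N : ℕ}
    (α : Fin N → Ω → Equiv.Perm (Fin L)) : ℝ :=
  (⨅ n, entropy μ (α n)) -
    (entropy μ (fun ω (n : Fin N) => α n ω) -
      entropy μ (fun ω (n : Fin (N - 1)) => transcripts α n ω))

theorem entropy_equiv_comp {Ω S : Type*} [MeasurableSpace Ω] [Fintype S]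
    (μ : Measure Ω) (X : Ω → S) (e : S ≃ S) :
    entropy μ (fun ω => e (X ω)) = entropy μ X := by
  unfold entropy
  rw [← Equiv.sum_comp e]
  refine Finset.sum_congr rfl fun s _ => ?_
  have h : (fun ω => e (X ω)) ⁻¹' {e s} = X ⁻¹' {s} := by
    ext ω
    simp
  rw [h]

theorem entropy_transcripts_zero {Ω : Type*} [MeasurableSpace Ω]
    (μ : Measure Ω) {L N : ℕ} (α : Fin N → Ω → Equiv.Perm (Fin L)) (k : ℕ) (hk : k < N) :
    entropy μ (fun ω => (α ⟨k, hk⟩ ω, fun m : Fin (N - 1) => transcripts α m ω)) =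
      entropy μ (fun ω => (α ⟨0, by omega⟩ ω, fun m : Fin (N - 1) => transcripts α m ω)) := by
  induction k with
  | zero => rfl
  | succ k ih =>
    rw [← ih (by omega)]
    let e : (Equiv.Perm (Fin L) × (Fin (N - 1) → Equiv.Perm (Fin L))) ≃
        (Equiv.Perm (Fin L) × (Fin (N - 1) → Equiv.Perm (Fin L))) :=
      { toFun := fun p => (p.2 ⟨k, by omega⟩ * p.1, p.2)
        invFun := fun p => ((p.2 ⟨k, by omega⟩)⁻¹ * p.1, p.2)
        left_inv := fun p => by simp
        right_inv := fun p => by simp }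
    rw [← entropy_equiv_comp μ (fun ω => (α ⟨k, by omega⟩ ω, fun m : Fin (N - 1) => transcripts α m ω)) e]
    congr 1
    funext ω
    simp [e, transcripts]

/-- Proposition 1: the conditional entropies
`H(αⁱ | (τ¹,…,τᴺ⁻¹))` coincide for all `1 ≤ i, j ≤ N`, where
`H(X|Y) = H(X,Y) − H(Y)`. -/
theorem cond_entropy_given_transcripts_eq {Ω : Type*} [MeasurableSpace Ω]
    (μ : Measure Ω) [IsProbabilityMeasure μ] {L N : ℕ} (hN : 2 ≤ N)
    (α : Fin N → Ω → Equiv.Perm (Fin L)) (i j : Fin N) :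
    entropy μ (fun ω => (α i ω, fun m : Fin (N - 1) => transcripts α m ω))
        - entropy μ (fun ω (m : Fin (N - 1)) => transcripts α m ω) =
      entropy μ (fun ω => (α j ω, fun m : Fin (N - 1) => transcripts α m ω))
        - entropy μ (fun ω (m : Fin (N - 1)) => transcripts α m ω) := by
  rw [entropy_transcripts_zero μ α i.1 i.2, entropy_transcripts_zero μ α j.1 j.2]
end

section
/- (Proposition 3, Invariance) Let N ≥ 2 and let α¹, …, αᴺ be random variables on a probability space taking values in the symmetric group S_L. Then the multivariate coupling complexity index is invariant under permutations of its arguments: for every permutation π of {1, …, N}, C(α^{π(1)}, …, α^{π(N)}) = C(α¹, …, αᴺ). -/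
open MeasureTheory Real

theorem entropy_congr_fibers {Ω S T : Type*} [MeasurableSpace Ω] [Fintype S] [Fintype T]
    (μ : Measure Ω) (X : Ω → S) (Y : Ω → T)
    (h : ∀ ω ω', X ω = X ω' ↔ Y ω = Y ω') : entropy μ X = entropy μ Y := by
  unfold entropy
  have key : ∀ {U : Type _} (Z : Ω → U) (s : U),
      Real.negMulLog ((μ (Z ⁻¹' {s})).toReal) ≠ 0 → ∃ ω, Z ω = s := by
    intro U Z s hs
    by_contra hne
    apply hs
    have : Z ⁻¹' {s} = ∅ := by
      ext ω
      simp only [Set.mem_preimage, Set.mem_singleton_iff, Set.mem_empty_iff_false, iff_false]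
      exact fun h' => hne ⟨ω, h'⟩
    simp [this]
  have key' : ∀ (s : T),
      Real.negMulLog ((μ (Y ⁻¹' {s})).toReal) ≠ 0 → ∃ ω, Y ω = s := by
    intro s hs
    by_contra hne
    apply hs
    have : Y ⁻¹' {s} = ∅ := by
      ext ω
      simp only [Set.mem_preimage, Set.mem_singleton_iff, Set.mem_empty_iff_false, iff_false]
      exact fun h' => hne ⟨ω, h'⟩
    simp [this]
  have fib : ∀ ω, X ⁻¹' {X ω} = Y ⁻¹' {Y ω} := by
    intro ω
    ext ω'
    simpa using h ω' ω
  refine Finset.sum_bij_ne_zero (fun s _ hs => Y (key X s hs).choose) ?_ ?_ ?_ ?_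
  · intros
    exact Finset.mem_univ _
  · intro s _ hs s' _ hs' he
    rw [← (key X s hs).choose_spec, ← (key X s' hs').choose_spec]
    exact (h _ _).2 he
  · intro t _ ht
    obtain ⟨ω, rfl⟩ := key' t ht
    rw [← fib] at ht
    exact ⟨X ω, Finset.mem_univ _, ht, (h _ _).1 (key X _ ht).choose_spec⟩
  · intro s _ hs
    have e := (key X s hs).choose_spec
    rw [← fib, e]

theorem transcripts_eq_iff {Ω : Type*} {L N : ℕ} (α : Fin N → Ω → Equiv.Perm (Fin L))
    (ω ω' : Ω) :
    ((fun n => transcripts α n ω) = fun n => transcripts α n ω') ↔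
      ∀ i j, α i ω * (α j ω)⁻¹ = α i ω' * (α j ω')⁻¹ := by
  constructor
  · intro h
    have base : ∀ (k : ℕ) (hk : k < N), α ⟨k, hk⟩ ω * (α ⟨0, by omega⟩ ω)⁻¹
        = α ⟨k, hk⟩ ω' * (α ⟨0, by omega⟩ ω')⁻¹ := by
      intro k
      induction k with
      | zero => intro hk; simp
      | succ k ih =>
        intro hk
        have h1 := ih (by omega)
        have h2 := congrFun h ⟨k, by omega⟩
        simp only [transcripts] at h2
        have h3 := congrArg₂ (· * ·) h2 h1
        simpa only [mul_assoc, inv_mul_cancel_left] using h3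
    intro i j
    have h3 := congrArg₂ (· * ·⁻¹) (base i i.2) (base j j.2)
    simpa only [mul_inv_rev, inv_inv, mul_assoc, inv_mul_cancel_left] using h3
  · intro h
    funext n
    exact h _ _

/-- Proposition 3, Invariance: the multivariate coupling
complexity index is invariant under permutations of its arguments. -/
theorem cci_perm_invariant {Ω : Type*} [MeasurableSpace Ω]
    (μ : Measure Ω) [IsProbabilityMeasure μ] {L N : ℕ} (hN : 2 ≤ N)
    (α : Fin N → Ω → Equiv.Perm (Fin L)) (σ : Equiv.Perm (Fin N)) :
    cci μ (fun n => α (σ n)) = cci μ α := by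
  unfold cci
  congr 1
  · exact σ.surjective.iInf_comp (fun n => entropy μ (α n))
  · congr 1
    · apply entropy_congr_fibers
      intro ω ω'
      simp only [funext_iff]
      exact σ.forall_congr_left.trans (by simp)
    · apply entropy_congr_fibers
      intro ω ω'
      rw [transcripts_eq_iff, transcripts_eq_iff]
      constructor
      · intro h i j
        simpa using h (σ.symm i) (σ.symm j)
      · intro h i j
        exact h _ _
end

section
/- Let N ≥ 2 and let α¹, …, αᴺ be random variables on a probability space taking values in the symmetric group S_L. For any indices i, j, write τ^{i,j} = αʲ·(αⁱ)⁻¹ (pointwise). Then for every permutation π of {1, …, N}, the joint entropy of the permuted consecutive transcripts equals that of the original consecutive transcripts: H(τ^{π(1),π(2)}, …, τ^{π(N−1),π(N)}) = H(τ^{1,2}, …, τ^{N−1,N}). -/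
open MeasureTheory Real

theorem entropy_comp_injective {Ω S : Type*} [MeasurableSpace Ω] [Fintype S]
    (μ : Measure Ω) (Y : Ω → S) (F : S → S) (hF : Function.Injective F) :
    entropy μ (fun ω => F (Y ω)) = entropy μ Y := by
  unfold entropy
  have hb : Function.Bijective F := Finite.injective_iff_bijective.mp hF
  symm
  apply Fintype.sum_bijective F hb
  intro s
  have : (fun ω => F (Y ω)) ⁻¹' {F s} = Y ⁻¹' {s} := by
    ext ω
    simp [hF.eq_iff]
  rw [this]

/-- Deterministic consecutive transcripts in a group. -/
def trMap {G : Type*} [Group G] {N : ℕ} (a : Fin N → G) : Fin (N - 1) → G :=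
  fun n => a ⟨n.1 + 1, by have := n.2; omega⟩ * (a ⟨n.1, by have := n.2; omega⟩)⁻¹

/-- Partial products. -/
def partProd {G : Type*} [Group G] {M : ℕ} (t : Fin M → G) : ℕ → G
  | 0 => 1
  | n + 1 => (if h : n < M then t ⟨n, h⟩ else 1) * partProd t n

theorem trMap_partProd {G : Type*} [Group G] {N : ℕ} (t : Fin (N - 1) → G) :
    trMap (fun i : Fin N => partProd t i.1) = t := by
  funext n
  simp [trMap, partProd]

theorem trMap_eq_iff {G : Type*} [Group G] {N : ℕ} (a b : Fin N → G) :
    trMap a = trMap b ↔ ∀ i j, a i * (a j)⁻¹ = b i * (b j)⁻¹ := by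
  constructor
  · intro h
    have key : ∀ (n : ℕ) (hn : n < N),
        a ⟨n, hn⟩ * (a ⟨0, by omega⟩)⁻¹ = b ⟨n, hn⟩ * (b ⟨0, by omega⟩)⁻¹ := by
      intro n
      induction n with
      | zero => intro hn; simp
      | succ k ih =>
        intro hn
        have h1 := ih (by omega)
        have h2 : a ⟨k + 1, hn⟩ * (a ⟨k, by omega⟩)⁻¹ = b ⟨k + 1, hn⟩ * (b ⟨k, by omega⟩)⁻¹ :=
          congrFun h ⟨k, by omega⟩
        have h3 := congrArg₂ (· * ·) h2 h1
        simpa [mul_assoc] using h3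
    intro i j
    have h3 := congrArg₂ (fun x y => x * y⁻¹) (key i.1 i.2) (key j.1 j.2)
    simpa [mul_assoc] using h3
  · intro h
    funext n
    exact h _ _

/-- the joint entropy of the permuted consecutive transcripts
`τ^{π(1),π(2)}, …, τ^{π(N−1),π(N)}` (with `τ^{i,j} = αʲ·(αⁱ)⁻¹`) equals the joint
entropy of the original consecutive transcripts `τ^{1,2}, …, τ^{N−1,N}`. -/
theorem entropy_permuted_transcripts {Ω : Type*} [MeasurableSpace Ω]
    (μ : Measure Ω) [IsProbabilityMeasure μ] {L N : ℕ} (hN : 2 ≤ N)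
    (α : Fin N → Ω → Equiv.Perm (Fin L)) (σ : Equiv.Perm (Fin N)) :
    entropy μ (fun ω (m : Fin (N - 1)) => transcripts (fun n => α (σ n)) m ω) =
      entropy μ (fun ω (m : Fin (N - 1)) => transcripts α m ω) := by
  let sec : (Fin (N - 1) → Equiv.Perm (Fin L)) → Fin N → Equiv.Perm (Fin L) :=
    fun t i => partProd t i.1
  have hsec : ∀ t, trMap (sec t) = t := fun t => trMap_partProd t
  let F : (Fin (N - 1) → Equiv.Perm (Fin L)) → (Fin (N - 1) → Equiv.Perm (Fin L)) :=
    fun t => trMap (fun n => sec t (σ n))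
  have hF : Function.Injective F := by
    intro t t' h
    have h1 := (trMap_eq_iff _ _).mp h
    rw [← hsec t, ← hsec t', trMap_eq_iff]
    intro i j
    simpa using h1 (σ.symm i) (σ.symm j)
  have hX : (fun ω (m : Fin (N - 1)) => transcripts (fun n => α (σ n)) m ω) =
      fun ω => F (fun m => transcripts α m ω) := by
    funext ω
    have h1 := (trMap_eq_iff (fun n => α n ω) (sec (trMap fun n => α n ω))).mp (hsec _).symm
    exact (trMap_eq_iff (fun n => α (σ n) ω)
      (fun n => sec (trMap fun n => α n ω) (σ n))).mpr fun i j => h1 _ _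
  rw [hX]
  exact entropy_comp_injective μ (fun ω m => transcripts α m ω) F hF
end

section
/- (Proposition 6) Let N ≥ 2 and let α¹, …, αᴺ be mutually independent random variables on a probability space, each uniformly distributed on the symmetric group S_L. Then the multivariate coupling complexity index vanishes: C(α¹, …, αᴺ) = 0. -/
open MeasureTheory Real

/-- If every atom has outer measure at most `1 / |S|`, the entropy is `log |S|`
(no measurability needed, only subadditivity). -/
lemma entropy_eq_log_card {Ω S : Type*} [MeasurableSpace Ω] [Fintype S]
    (μ : Measure Ω) [IsProbabilityMeasure μ] (X : Ω → S)
    (h : ∀ s, μ (X ⁻¹' {s}) ≤ ((Fintype.card S : ℕ) : ENNReal)⁻¹) :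
    entropy μ X = Real.log (Fintype.card S) := by
  obtain ⟨ω₀⟩ : Nonempty Ω := μ.nonempty_of_neZero
  have : Nonempty S := ⟨X ω₀⟩
  have hc : (Fintype.card S : ℝ) ≠ 0 := by
    exact_mod_cast Fintype.card_ne_zero
  have hle : ∀ s ∈ (Finset.univ : Finset S),
      (μ (X ⁻¹' {s})).toReal ≤ (Fintype.card S : ℝ)⁻¹ := by
    intro s _
    have h2 := ENNReal.toReal_mono (by simp) (h s)
    simpa using h2
  have hone : (1 : ℝ) ≤ ∑ s : S, (μ (X ⁻¹' {s})).toReal := by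
    have h1 : μ (⋃ s, X ⁻¹' {s}) ≤ ∑ s : S, μ (X ⁻¹' {s}) := measure_iUnion_fintype_le μ _
    have h2 : (⋃ s, X ⁻¹' {s}) = Set.univ := by
      ext ω; simp
    rw [h2, measure_univ] at h1
    have h3 := ENNReal.toReal_mono (by simp) h1
    rw [ENNReal.toReal_sum (by simp)] at h3
    simpa using h3
  have hsum : ∑ s : S, (μ (X ⁻¹' {s})).toReal = ∑ _s : S, (Fintype.card S : ℝ)⁻¹ := by
    apply le_antisymm (Finset.sum_le_sum hle)
    simpa [hc] using hone
  have heq := (Finset.sum_eq_sum_iff_of_le hle).1 hsum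
  unfold entropy
  rw [Finset.sum_congr rfl (fun s hs => by rw [heq s hs])]
  simp [Real.negMulLog, hc]

lemma transcripts_inj {Ω : Type*} {L N : ℕ} (hN : 0 < N)
    (α : Fin N → Ω → Equiv.Perm (Fin L)) (ω ω' : Ω)
    (h0 : α ⟨0, hN⟩ ω = α ⟨0, hN⟩ ω')
    (ht : ∀ n, transcripts α n ω = transcripts α n ω') (n : Fin N) :
    α n ω = α n ω' := by
  obtain ⟨k, hk⟩ := n
  induction k with
  | zero => exact h0
  | succ k ih =>
    have h1 := ih (by omega)
    have h2 := ht ⟨k, by omega⟩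
    simp only [transcripts] at h2
    rw [h1] at h2
    exact mul_right_cancel h2

/-- Proposition 6: if `α¹,…,αᴺ` are mutually independent and each
uniformly distributed on `S_L`, then `C(α¹,…,αᴺ) = 0`. -/
theorem cci_eq_zero_of_indep_uniform {Ω : Type*} [MeasurableSpace Ω]
    (μ : Measure Ω) [IsProbabilityMeasure μ] {L N : ℕ} (hN : 2 ≤ N)
    (α : Fin N → Ω → Equiv.Perm (Fin L))
    (hind : ∀ a : Fin N → Equiv.Perm (Fin L),
      μ (⋂ n, (α n) ⁻¹' {a n}) = ∏ n, μ ((α n) ⁻¹' {a n}))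
    (hunif : ∀ (n : Fin N) (a : Equiv.Perm (Fin L)),
      μ ((α n) ⁻¹' {a}) = 1 / (Nat.factorial L : ENNReal)) :
    cci μ α = 0 := by
  have hcard : Fintype.card (Equiv.Perm (Fin L)) = L.factorial := by
    simp [Fintype.card_perm]
  have hF0 : (L.factorial : ENNReal) ≠ 0 := by
    exact_mod_cast L.factorial_ne_zero
  have hFt : (L.factorial : ENNReal) ≠ ⊤ := by simp
  have hjoint : ∀ a : Fin N → Equiv.Perm (Fin L),
      μ ((fun ω (n : Fin N) => α n ω) ⁻¹' {a}) = ((L.factorial : ENNReal) ^ N)⁻¹ := by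
    intro a
    have hs : ((fun ω (n : Fin N) => α n ω) ⁻¹' {a}) = ⋂ n, (α n) ⁻¹' {a n} := by
      ext ω; simp [funext_iff]
    rw [hs, hind]
    simp [hunif, ENNReal.inv_pow]
  have e1 : ∀ n, entropy μ (α n) = Real.log L.factorial := by
    intro n
    rw [entropy_eq_log_card μ (α n), hcard]
    intro s
    rw [hunif, hcard, one_div]
  have e2 : entropy μ (fun ω (n : Fin N) => α n ω) = N * Real.log L.factorial := by
    rw [entropy_eq_log_card]
    · simp [hcard, Fintype.card_perm]
    · intro a
      rw [hjoint]
      simp [hcard, Fintype.card_perm]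
  have e3 : entropy μ (fun ω (n : Fin (N - 1)) => transcripts α n ω)
      = (N - 1 : ℕ) * Real.log L.factorial := by
    rw [entropy_eq_log_card]
    · simp [hcard, Fintype.card_perm]
    · intro t
      have hsub : ((fun ω (n : Fin (N - 1)) => transcripts α n ω) ⁻¹' {t}) ⊆
          ⋃ g : Equiv.Perm (Fin L), {ω | α ⟨0, by omega⟩ ω = g ∧
            ∀ n, transcripts α n ω = t n} := by
        intro ω hω
        simp only [Set.mem_iUnion]
        exact ⟨_, rfl, fun n => congrFun hω n⟩
      have hpiece : ∀ g : Equiv.Perm (Fin L), μ {ω | α ⟨0, by omega⟩ ω = g ∧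
            ∀ n, transcripts α n ω = t n} ≤ ((L.factorial : ENNReal) ^ N)⁻¹ := by
        intro g
        rcases Set.eq_empty_or_nonempty {ω | α ⟨0, by omega⟩ ω = g ∧
            ∀ n, transcripts α n ω = t n} with he | ⟨ω', h1, h2⟩
        · rw [he]; simp
        · rw [← hjoint (fun n => α n ω')]
          apply measure_mono
          rintro ω ⟨h3, h4⟩
          exact funext (transcripts_inj (by omega) α ω ω' (h3.trans h1.symm)
            (fun n => (h4 n).trans (h2 n).symm))
      refine (measure_mono hsub).trans ((measure_iUnion_fintype_le μ _).trans
        ((Finset.sum_le_sum (fun g _ => hpiece g)).trans (le_of_eq ?_)))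
      obtain ⟨m, rfl⟩ : ∃ m, N = m + 1 := ⟨N - 1, by omega⟩
      simp only [Finset.sum_const, Finset.card_univ, hcard, nsmul_eq_mul, Fintype.card_fun,
        Fintype.card_fin, Nat.add_sub_cancel, Nat.cast_pow]
      rw [pow_succ, ENNReal.mul_inv (Or.inr hFt) (Or.inr hF0), mul_comm, mul_assoc,
        ENNReal.inv_mul_cancel hF0 hFt, mul_one]
  have : Nonempty (Fin N) := ⟨⟨0, by omega⟩⟩
  unfold cci
  rw [e2, e3]
  simp only [e1, ciInf_const]
  rw [Nat.cast_sub (by omega)]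
  push_cast
  ring
end
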